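/- Let y = φ(x, u, u_[1], …, u_[q]) be a flat output of a flat discrete-time system x⁺ = f(x,u) with parametrization x = F_x(y_[0,R−1]), u = F_u(y_[0,R]). Then for every s ∈ {1,…,m} and every i = 1,…,n the identity δ_y(∂_{y^s_[r_s−1]} F_x^i) = (∂_{u^j} f^i ∘ F) · ∂_{y^s_[r_s]} F_u^j holds (summation over j = 1,…,m), where F = (F_x, F_u) and δ_y is the forward-shift operator in the coordinates (y, y_[1], y_[2], …). -/

import Mathlib

/-!
Discrete-time systems `x⁺ = f(x,u)` and difference flatness, following
Kolar–Schöberl–Diwold, "Differential-Geometric Decomposition of Flat Nonlinear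
Discrete-Time Systems".
-/

open Filter Topology Function

noncomputable section

/-- The forward-shift operator `δ_{xu}` on the space with coordinates
`(x, u, u_[1], u_[2], …)`: a point `(x, (u, u_[1], …))` is sent to
`(f(x,u), (u_[1], u_[2], …))`.  Composing functions with this map realizes the
forward shift of functions. -/
def shift {X U : Type*} (f : X → U → X) : X × (ℕ → U) → X × (ℕ → U) :=
  fun p => (f p.1 (p.2 0), fun k => p.2 (k + 1))

/-- `φ` is a smooth function `φ(x, u, u_[1], …, u_[q])` of the state and finitely
many forward-shifts of the input. -/
def SmoothFiniteDep {X U Y : Type*} [NormedAddCommGroup X] [NormedSpace ℝ X]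
    [NormedAddCommGroup U] [NormedSpace ℝ U] [NormedAddCommGroup Y] [NormedSpace ℝ Y]
    (φ : X × (ℕ → U) → Y) : Prop :=
  ∃ (q : ℕ) (ψ : X × (Fin (q + 1) → U) → Y),
    ContDiff ℝ (⊤ : ℕ∞) ψ ∧ ∀ p, φ p = ψ (p.1, fun k => p.2 k)

/-- `φ` is a flat output of the system `x⁺ = f(x,u)` around `(x₀,u₀)`:
it is a smooth function of `(x, u, u_[1], …, u_[q])`, and locally around the
point `(x₀, (u₀, u₀, …))` the state `x` and the input `u` can be expressed as a
(smooth) function `E` of `φ` and finitely many of its forward shifts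
`φ ∘ δ_{xu}^α`. -/
def IsFlatOutput {X U Y : Type*} [NormedAddCommGroup X] [NormedSpace ℝ X]
    [NormedAddCommGroup U] [NormedSpace ℝ U] [NormedAddCommGroup Y] [NormedSpace ℝ Y]
    (f : X → U → X) (x₀ : X) (u₀ : U) (φ : X × (ℕ → U) → Y) : Prop :=
  SmoothFiniteDep φ ∧
  ∃ (N : ℕ) (E : (Fin N → Y) → X × U), ContDiff ℝ (⊤ : ℕ∞) E ∧
    ∀ᶠ p in 𝓝 ((x₀, fun _ => u₀) : X × (ℕ → U)),
      E (fun α => φ ((shift f)^[(α : ℕ)] p)) = (p.1, p.2 0)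

/-- The system `x⁺ = f(x,u)` is flat around `(x₀,u₀)` if it possesses a flat
output (an `m`-tuple of functions, i.e. a function valued in the input space). -/
def IsFlat {X U : Type*} [NormedAddCommGroup X] [NormedSpace ℝ X]
    [NormedAddCommGroup U] [NormedSpace ℝ U]
    (f : X → U → X) (x₀ : X) (u₀ : U) : Prop :=
  ∃ φ : X × (ℕ → U) → U, IsFlatOutput f x₀ u₀ φ

open Polynomial

/-- If `m` vectors of a module over `K[T]` span `m` independent vectors, then they are independent:
here for the module of linear functionals on `V`, with `T` acting by precomposition with `L`. -/
theorem aeval_dualMap_independent_of_span {K V ι : Type*} [Field K] [AddCommGroup V] [Module K V]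
    [Fintype ι] (L : V →ₗ[K] V) (ω η : ι → Module.Dual K V)
    (hη : ∀ P : ι → K[X], ∑ j, aeval L.dualMap (P j) (η j) = 0 → P = 0)
    (hspan : ∀ i, ∃ Q : ι → K[X], η i = ∑ j, aeval L.dualMap (Q j) (ω j))
    (P : ι → K[X]) (hP : ∑ j, aeval L.dualMap (P j) (ω j) = 0) : P = 0 := by
  let M := Module.AEval' L.dualMap
  let of := Module.AEval'.of L.dualMap
  let comb (θ : ι → Module.Dual K V) : (ι → K[X]) →ₗ[K[X]] M :=
    Fintype.linearCombination K[X] fun j => of (θ j)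
  have comb_apply (θ : ι → Module.Dual K V) (Q : ι → K[X]) :
      comb θ Q = of (∑ j, aeval L.dualMap (Q j) (θ j)) := by
    rw [map_sum]
    exact Finset.sum_congr rfl fun j _ => (Module.AEval.of_aeval_smul _ _ _).symm
  have hle (Q : ι → K[X]) : comb η Q ∈ LinearMap.range (comb ω) := by
    refine Submodule.sum_mem _ fun i _ => Submodule.smul_mem _ _ ?_
    obtain ⟨S, hS⟩ := hspan i
    exact ⟨S, by rw [comb_apply, ← hS]⟩
  have hinj : Function.Injective ((comb η).codRestrict (LinearMap.range (comb ω)) hle) := by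
    refine (injective_iff_map_eq_zero _).2 fun Q hQ => hη Q ?_
    have : comb η Q = 0 := congrArg Subtype.val hQ
    rw [comb_apply] at this
    exact of.map_eq_zero_iff.1 this
  have := OrzechProperty.injective_of_surjective_of_injective _ (comb ω).rangeRestrict hinj
    (comb ω).surjective_rangeRestrict
  refine (injective_iff_map_eq_zero _).1 this P (Subtype.ext ?_)
  change comb ω P = 0
  rw [comb_apply, hP, map_zero]

theorem aeval_dualMap_apply {K V : Type*} [Field K] [AddCommGroup V] [Module K V]
    (L : V →ₗ[K] V) (ω : Module.Dual K V) (P : K[X]) (v : V) :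
    aeval L.dualMap P ω v = P.sum fun k c => c * ω ((L ^ k) v) := by
  have hpow (k : ℕ) : (L.dualMap ^ k) ω v = ω ((L ^ k) v) := by
    induction k generalizing v with
    | zero => rfl
    | succ k ih => rw [pow_succ', pow_succ, Module.End.mul_apply, LinearMap.dualMap_apply, ih,
        Module.End.mul_apply]
  simp [aeval_eq_sum_range, Polynomial.sum_over_range, hpow, LinearMap.sum_apply]

theorem dual_pi_pi_apply {K ι : Type*} {κ : ι → Type*} [Field K] [Fintype ι] [DecidableEq ι]
    [∀ i, Fintype (κ i)] [∀ i, DecidableEq (κ i)] (e : Module.Dual K ((i : ι) → κ i → K))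
    (y : (i : ι) → κ i → K) :
    e y = ∑ i, ∑ k, y i k * e (Pi.single i (Pi.single k 1)) := by
  have hy : y = ∑ i, ∑ k, y i k • Pi.single i (Pi.single k (1 : K)) := by
    ext i k
    simp only [Finset.sum_apply, Pi.smul_apply, smul_eq_mul]
    rw [Finset.sum_eq_single i (fun j _ hj => by simp [Pi.single_eq_of_ne' hj]) (by simp)]
    simp [Pi.single_apply]
  conv_lhs => rw [hy]
  simp only [map_sum, map_smul, smul_eq_mul]

theorem continuous_shift {X U : Type*} [TopologicalSpace X] [TopologicalSpace U] {f : X → U → X}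
    (hf : Continuous fun q : X × U => f q.1 q.2) : Continuous (shift f) :=
  (hf.comp (by fun_prop : Continuous fun p : X × (ℕ → U) => (p.1, p.2 0))).prodMk (by fun_prop)

section Linearization

variable {X U : Type*} [NormedAddCommGroup X] [NormedSpace ℝ X]
  [NormedAddCommGroup U] [NormedSpace ℝ U]

/-- The linear forward shift of the linear system `x⁺ = A (x, u)`. -/
def linearShift (A : X × U →L[ℝ] X) : X × (ℕ → U) →ₗ[ℝ] X × (ℕ → U) where
  toFun v := (A (v.1, v.2 0), fun k => v.2 (k + 1))
  map_add' v w := by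
    ext
    · exact map_add A (v.1, v.2 0) (w.1, w.2 0)
    · rfl
  map_smul' c v := by
    ext
    · exact map_smul A c (v.1, v.2 0)
    · rfl

theorem linearShift_pow_apply_snd (A : X × U →L[ℝ] X) (k : ℕ) (v : X × (ℕ → U)) (l : ℕ) :
    ((linearShift A ^ k) v).2 l = v.2 (l + k) := by
  induction k generalizing l with
  | zero => rfl
  | succ k ih =>
    rw [pow_succ', Module.End.mul_apply]
    change ((linearShift A ^ k) v).2 (l + 1) = _
    rw [ih, add_assoc, add_comm 1 k]

/-- Componentwise differentiability at `0` of a curve through `p` with velocity `v`. -/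
def CurveHasDeriv (c : ℝ → X × (ℕ → U)) (p v : X × (ℕ → U)) : Prop :=
  c 0 = p ∧ HasDerivAt (fun t => (c t).1) v.1 0 ∧ ∀ k, HasDerivAt (fun t => (c t).2 k) (v.2 k) 0

theorem curveHasDeriv_line (p v : X × (ℕ → U)) : CurveHasDeriv (fun t => p + t • v) p v := by
  refine ⟨by simp, ?_, fun k => ?_⟩
  · simpa using ((hasDerivAt_id (0 : ℝ)).smul_const v.1).const_add p.1
  · simpa using ((hasDerivAt_id (0 : ℝ)).smul_const (v.2 k)).const_add (p.2 k)

theorem CurveHasDeriv.tendsto {c : ℝ → X × (ℕ → U)} {p v : X × (ℕ → U)}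
    (hc : CurveHasDeriv c p v) : Tendsto c (𝓝 0) (𝓝 p) := by
  obtain ⟨h0, h1, h2⟩ := hc
  rw [← h0]
  exact h1.continuousAt.prodMk (continuousAt_pi.2 fun k => (h2 k).continuousAt)

theorem CurveHasDeriv.shift {f : X → U → X} {A : X × U →L[ℝ] X} {p : X × (ℕ → U)}
    (hA : HasFDerivAt (fun q : X × U => f q.1 q.2) A (p.1, p.2 0)) (hp : shift f p = p)
    {c : ℝ → X × (ℕ → U)} {v : X × (ℕ → U)} (hc : CurveHasDeriv c p v) :
    CurveHasDeriv (fun t => shift f (c t)) p (linearShift A v) := by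
  obtain ⟨h0, h1, h2⟩ := hc
  refine ⟨by simp only [h0, hp], ?_, fun k => h2 (k + 1)⟩
  have hA' : HasFDerivAt (fun q : X × U => f q.1 q.2) A ((c 0).1, (c 0).2 0) := by rwa [h0]
  exact hA'.comp_hasDerivAt (0 : ℝ) (h1.prodMk (h2 0))

theorem CurveHasDeriv.shift_iterate {f : X → U → X} {A : X × U →L[ℝ] X} {p : X × (ℕ → U)}
    (hA : HasFDerivAt (fun q : X × U => f q.1 q.2) A (p.1, p.2 0)) (hp : _root_.shift f p = p)
    {c : ℝ → X × (ℕ → U)} {v : X × (ℕ → U)} (hc : CurveHasDeriv c p v) (k : ℕ) :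
    CurveHasDeriv (fun t => (_root_.shift f)^[k] (c t)) p ((linearShift A ^ k) v) := by
  induction k with
  | zero => exact hc
  | succ k ih =>
    simp only [Function.iterate_succ_apply', pow_succ', Module.End.mul_apply]
    exact ih.shift hA hp

/-- A smooth function of `x` and finitely many inputs has a linearization along curves. -/
theorem SmoothFiniteDep.exists_linearization {Y : Type*} [NormedAddCommGroup Y] [NormedSpace ℝ Y]
    {φ : X × (ℕ → U) → Y} (hφ : SmoothFiniteDep φ) (p : X × (ℕ → U)) :
    ∃ D : X × (ℕ → U) →ₗ[ℝ] Y, ∀ c v, CurveHasDeriv c p v →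
      HasDerivAt (fun t => φ (c t)) (D v) 0 := by
  obtain ⟨q, ψ, hψ, hφψ⟩ := hφ
  let res : X × (ℕ → U) →ₗ[ℝ] X × (Fin (q + 1) → U) :=
    LinearMap.prodMap LinearMap.id (LinearMap.funLeft ℝ U fun k : Fin (q + 1) => (k : ℕ))
  refine ⟨(fderiv ℝ ψ (res p)).toLinearMap ∘ₗ res, fun c v ⟨h0, h1, h2⟩ => ?_⟩
  have hd : HasFDerivAt ψ (fderiv ℝ ψ (res p)) (res (c 0)) := by
    rw [h0]
    exact (hψ.differentiable (by simp)).differentiableAt.hasFDerivAt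
  have := hd.comp_hasDerivAt (0 : ℝ) (h1.prodMk (hasDerivAt_pi.2 fun k : Fin (q + 1) => h2 k))
  simp only [hφψ]
  exact this

theorem SmoothFiniteDep.contDiff_comp_shift_iterate {Y W : Type*} [NormedAddCommGroup Y]
    [NormedSpace ℝ Y] [NormedAddCommGroup W] [NormedSpace ℝ W] {φ : X × (ℕ → U) → Y}
    (hφ : SmoothFiniteDep φ) {f : X → U → X}
    (hf : ContDiff ℝ (⊤ : ℕ∞) fun q : X × U => f q.1 q.2) {G : W → X × (ℕ → U)}
    (h1 : ContDiff ℝ (⊤ : ℕ∞) fun w => (G w).1)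
    (h2 : ∀ k, ContDiff ℝ (⊤ : ℕ∞) fun w => (G w).2 k) (k : ℕ) :
    ContDiff ℝ (⊤ : ℕ∞) fun w => φ ((shift f)^[k] (G w)) := by
  induction k generalizing G with
  | zero =>
    obtain ⟨q, ψ, hψ, hφψ⟩ := hφ
    simp only [Function.iterate_zero, id, hφψ]
    exact hψ.comp (h1.prodMk (contDiff_pi.2 fun k => h2 k))
  | succ k ih =>
    simp only [Function.iterate_succ_apply]
    exact ih (G := fun w => shift f (G w)) (hf.comp (h1.prodMk (h2 0))) fun l => h2 (l + 1)

end Linearization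

/-- At an equilibrium, the differentials of the components of a flat output and of their forward
shifts are linearly independent. -/
theorem IsFlatOutput.differentials_independent {X : Type*} [NormedAddCommGroup X]
    [NormedSpace ℝ X] {m : ℕ} {f : X → (Fin m → ℝ) → X} {x₀ : X} {u₀ : Fin m → ℝ}
    {φ : X × (ℕ → Fin m → ℝ) → (Fin m → ℝ)} (hflat : IsFlatOutput f x₀ u₀ φ)
    (heq : shift f (x₀, fun _ => u₀) = (x₀, fun _ => u₀)) {A : X × (Fin m → ℝ) →L[ℝ] X}
    (hA : HasFDerivAt (fun q : X × (Fin m → ℝ) => f q.1 q.2) A (x₀, u₀))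
    {D : X × (ℕ → Fin m → ℝ) →ₗ[ℝ] (Fin m → ℝ)}
    (hD : ∀ c v, CurveHasDeriv c (x₀, fun _ => u₀) v → HasDerivAt (fun t => φ (c t)) (D v) 0)
    (P : Fin m → ℝ[X])
    (hP : ∑ j, aeval (linearShift A).dualMap (P j) (LinearMap.proj j ∘ₗ D) = 0) : P = 0 := by
  obtain ⟨-, N, E, hE, hEφ⟩ := hflat
  let input (j : Fin m) : Module.Dual ℝ (X × (ℕ → Fin m → ℝ)) :=
    LinearMap.proj j ∘ₗ LinearMap.proj 0 ∘ₗ LinearMap.snd ℝ X (ℕ → Fin m → ℝ)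
  refine aeval_dualMap_independent_of_span (linearShift A) _ input ?_ ?_ P hP
  · intro Q hQ
    ext j k
    have := LinearMap.congr_fun hQ (0, Pi.single k (Pi.single j 1))
    simp only [LinearMap.sum_apply, aeval_dualMap_apply] at this
    have hin (i : Fin m) (l : ℕ) :
        input i ((linearShift A ^ l) (0, Pi.single k (Pi.single j 1)))
          = if i = j then if l = k then 1 else 0 else 0 := by
      change ((linearShift A ^ l) _).2 0 i = _
      rw [linearShift_pow_apply_snd]
      by_cases hl : l = k
      · subst hl; simp [Pi.single_apply]
      · simp [hl]
    simp only [hin] at this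
    simpa [Polynomial.sum_def] using this
  · intro i
    let z : Fin N → Fin m → ℝ := fun α => φ ((shift f)^[(α : ℕ)] (x₀, fun _ => u₀))
    let e : Module.Dual ℝ (Fin N → Fin m → ℝ) :=
      LinearMap.proj i ∘ₗ LinearMap.snd ℝ X (Fin m → ℝ) ∘ₗ (fderiv ℝ E z).toLinearMap
    have hin (v) : input i v = e fun α => D ((linearShift A ^ (α : ℕ)) v) := by
      have hc := curveHasDeriv_line (x₀, fun _ => u₀) v
      have hd : HasFDerivAt E (fderiv ℝ E z) (fun α : Fin N => φ ((shift f)^[(α : ℕ)]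
          ((x₀, fun _ => u₀) + (0 : ℝ) • v))) := by
        rw [zero_smul, add_zero]
        exact (hE.differentiable (by simp)).differentiableAt.hasFDerivAt
      have h1 := hd.comp_hasDerivAt (0 : ℝ)
        (hasDerivAt_pi.2 fun α : Fin N => hD _ _ (hc.shift_iterate hA heq α))
      have h2 := (hc.2.1.prodMk (hc.2.2 0)).congr_of_eventuallyEq (hc.tendsto.eventually hEφ)
      exact congrFun (congrArg Prod.snd (h2.unique h1)) i
    refine ⟨fun j => ∑ α : Fin N, monomial (α : ℕ) (e (Pi.single α (Pi.single j 1))), ?_⟩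
    refine LinearMap.ext fun v => ?_
    rw [hin, dual_pi_pi_apply, Finset.sum_comm]
    simp only [map_sum, LinearMap.sum_apply, aeval_dualMap_apply]
    refine Finset.sum_congr rfl fun j _ => Finset.sum_congr rfl fun α _ => ?_
    rw [Polynomial.sum_monomial_index _ _ (by simp), mul_comm]
    rfl

/-- Around an equilibrium, any values of a flat output and of finitely many of its forward shifts
are attained at points close to the equilibrium. -/
theorem IsFlatOutput.nhds_le_map {X : Type*} [NormedAddCommGroup X]
    [NormedSpace ℝ X] {m : ℕ} {f : X → (Fin m → ℝ) → X} {x₀ : X} {u₀ : Fin m → ℝ}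
    {φ : X × (ℕ → Fin m → ℝ) → (Fin m → ℝ)} (hflat : IsFlatOutput f x₀ u₀ φ)
    (hf : ContDiff ℝ (⊤ : ℕ∞) fun q : X × (Fin m → ℝ) => f q.1 q.2)
    (heq : shift f (x₀, fun _ => u₀) = (x₀, fun _ => u₀)) (r : Fin m → ℕ) :
    𝓝 (fun j (α : Fin (r j)) => φ ((shift f)^[(α : ℕ)] (x₀, fun _ => u₀)) j) ≤
      map (fun p j (α : Fin (r j)) => φ ((shift f)^[(α : ℕ)] p) j)
        (𝓝 ((x₀, fun _ => u₀) : X × (ℕ → Fin m → ℝ))) := by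
  set p₀ : X × (ℕ → Fin m → ℝ) := (x₀, fun _ => u₀)
  obtain ⟨D, hD⟩ := hflat.1.exists_linearization p₀
  have hA := ((hf.differentiable (by simp)).differentiableAt (x := (x₀, u₀))).hasFDerivAt
  set A := fderiv ℝ (fun q : X × (Fin m → ℝ) => f q.1 q.2) (x₀, u₀)
  let Λ : X × (ℕ → Fin m → ℝ) →ₗ[ℝ] ((j : Fin m) → Fin (r j) → ℝ) :=
    LinearMap.pi fun j => LinearMap.pi fun α =>
      LinearMap.proj j ∘ₗ D ∘ₗ (linearShift A ^ (α : ℕ))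
  have hΛ : LinearMap.range Λ = ⊤ := by
    by_contra hne
    obtain ⟨e, he, hle⟩ := Submodule.exists_le_ker_of_lt_top _ (lt_top_iff_ne_top.2 hne)
    let P : Fin m → ℝ[X] := fun j =>
      ∑ α : Fin (r j), monomial (α : ℕ) (e (Pi.single j (Pi.single α 1)))
    have hP : P = 0 := by
      refine hflat.differentials_independent heq hA hD P (LinearMap.ext fun v => ?_)
      have hv : e (Λ v) = 0 := hle ⟨v, rfl⟩
      rw [dual_pi_pi_apply] at hv
      rw [LinearMap.zero_apply, ← hv]
      simp only [P, map_sum, LinearMap.sum_apply, aeval_dualMap_apply]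
      refine Finset.sum_congr rfl fun j _ => Finset.sum_congr rfl fun α _ => ?_
      rw [Polynomial.sum_monomial_index _ _ (by simp), mul_comm]
      rfl
    have hcoeff (j : Fin m) (α : Fin (r j)) : e (Pi.single j (Pi.single α 1)) = 0 := by
      have := congrArg (fun Q : ℝ[X] => Q.coeff α) (congrFun hP j)
      simpa [P, Polynomial.coeff_monomial, ← Fin.ext_iff] using this
    refine he (LinearMap.ext fun y => ?_)
    rw [dual_pi_pi_apply]
    simp [hcoeff]
  obtain ⟨σ, hσ⟩ := Λ.exists_rightInverse_of_surjective hΛ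
  let G : ((j : Fin m) → Fin (r j) → ℝ) → X × (ℕ → Fin m → ℝ) := fun w => p₀ + σ w
  have hG1 : ContDiff ℝ (⊤ : ℕ∞) fun w => (G w).1 :=
    contDiff_const.add (LinearMap.toContinuousLinearMap (LinearMap.fst ℝ _ _ ∘ₗ σ)).contDiff
  have hG2 (k : ℕ) : ContDiff ℝ (⊤ : ℕ∞) fun w => (G w).2 k :=
    contDiff_const.add (LinearMap.toContinuousLinearMap
      (LinearMap.proj k ∘ₗ LinearMap.snd ℝ _ _ ∘ₗ σ)).contDiff
  have hG : Continuous G := hG1.continuous.prodMk (continuous_pi fun k => (hG2 k).continuous)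
  have hG0 : G 0 = p₀ := by simp [G]
  let g : ((j : Fin m) → Fin (r j) → ℝ) → ((j : Fin m) → Fin (r j) → ℝ) :=
    fun w j α => φ ((shift f)^[(α : ℕ)] (G w)) j
  have hg : ContDiff ℝ (⊤ : ℕ∞) g := contDiff_pi.2 fun j => contDiff_pi.2 fun α =>
    contDiff_pi.1 (hflat.1.contDiff_comp_shift_iterate hf hG1 hG2 α) j
  have hg' : HasStrictFDerivAt g (fderiv ℝ g 0) 0 :=
    hg.contDiffAt.hasStrictFDerivAt (by simp)
  have hid (w) : fderiv ℝ g 0 w = w := by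
    have hc : CurveHasDeriv (fun t : ℝ => G (t • w)) p₀ (σ w) := by
      simpa [G] using curveHasDeriv_line p₀ (σ w)
    have h1 : HasDerivAt (fun t : ℝ => g (t • w)) (Λ (σ w)) 0 :=
      hasDerivAt_pi.2 fun j => hasDerivAt_pi.2 fun α =>
        hasDerivAt_pi.1 (hD _ _ (hc.shift_iterate hA heq α)) j
    have hline : HasDerivAt (fun t : ℝ => t • w) w 0 := by
      simpa using (hasDerivAt_id (0 : ℝ)).smul_const w
    have h2 := HasFDerivAt.comp_hasDerivAt (0 : ℝ) (f := fun t : ℝ => t • w)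
      (by rw [zero_smul]; exact hg'.hasFDerivAt) hline
    rw [h2.unique h1]
    exact LinearMap.congr_fun hσ w
  have hmap := hg'.map_nhds_eq_of_surj (LinearMap.range_eq_top.2 fun w => ⟨w, hid w⟩)
  have hg0 : g 0 = fun j (α : Fin (r j)) => φ ((shift f)^[(α : ℕ)] p₀) j := by
    simp only [g, hG0]
  rw [← hg0, ← hmap]
  have hle : map G (𝓝 0) ≤ 𝓝 p₀ := hG0 ▸ hG.continuousAt
  exact (map_map (m := G) (m' := fun p j (α : Fin (r j)) => φ ((shift f)^[(α : ℕ)] p) j)).ge.trans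
    (map_mono hle)

/-- Let `y = φ` be a flat output of `x⁺ = f(x,u)` with
parametrization `x = F_x(y_[0,R−1])`, `u = F_u(y_[0,R])`.  Then for every
`s ∈ {1,…,m}` (with `r_s ≥ 1`) and every `i` the identity
`δ_y(∂_{y^s_[r_s−1]} F_x^i) = (∂_{u^j} f^i ∘ F) · ∂_{y^s_[r_s]} F_u^j`
(summation over `j`) holds as an identity in the free variables `y_[0,R]`,
locally around their values at the equilibrium.  The partial derivatives are
realized as directional derivatives along the corresponding coordinate
directions. -/
theorem flat_parametrization_differentiated_shift_identity {n m : ℕ}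
    (f : (Fin n → ℝ) → (Fin m → ℝ) → (Fin n → ℝ))
    (hf : ContDiff ℝ (⊤ : ℕ∞) fun p : (Fin n → ℝ) × (Fin m → ℝ) => f p.1 p.2)
    (hsub : ∀ x u, Function.Surjective
      (fderiv ℝ (fun p : (Fin n → ℝ) × (Fin m → ℝ) => f p.1 p.2) (x, u)))
    (x₀ : Fin n → ℝ) (u₀ : Fin m → ℝ) (heq : x₀ = f x₀ u₀)
    (φ : (Fin n → ℝ) × (ℕ → Fin m → ℝ) → (Fin m → ℝ))
    (hflat : IsFlatOutput f x₀ u₀ φ)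
    -- the parametrization `x = F_x(y_[0,R−1])`, `u = F_u(y_[0,R])`:
    (R : Fin m → ℕ)
    (Fx : ((j : Fin m) → Fin (R j) → ℝ) → (Fin n → ℝ))
    (Fu : ((j : Fin m) → Fin (R j + 1) → ℝ) → (Fin m → ℝ))
    (hFx : ContDiff ℝ (⊤ : ℕ∞) Fx) (hFu : ContDiff ℝ (⊤ : ℕ∞) Fu)
    (hpar : ∀ᶠ p in 𝓝 ((x₀, fun _ => u₀) : (Fin n → ℝ) × (ℕ → Fin m → ℝ)),
      Fx (fun j (α : Fin (R j)) => φ ((shift f)^[(α : ℕ)] p) j) = p.1 ∧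
      Fu (fun j (α : Fin (R j + 1)) => φ ((shift f)^[(α : ℕ)] p) j) = p.2 0)
    (s : Fin m) (hs : 0 < R s) :
    -- the coordinate direction `∂_{y^s_[r_s−1]}` in the domain of `F_x`
    ∀ d₁ : (j : Fin m) → Fin (R j) → ℝ,
      d₁ = (fun j (α : Fin (R j)) => if j = s ∧ (α : ℕ) = R s - 1 then (1 : ℝ) else 0) →
    -- the coordinate direction `∂_{y^s_[r_s]}` in the domain of `F_u`
    ∀ d₂ : (j : Fin m) → Fin (R j + 1) → ℝ,
      d₂ = (fun j (α : Fin (R j + 1)) => if j = s ∧ (α : ℕ) = R s then (1 : ℝ) else 0) →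
    ∀ᶠ z in 𝓝 ((fun j (α : Fin (R j + 1)) =>
        φ ((shift f)^[(α : ℕ)]
          ((x₀, fun _ => u₀) : (Fin n → ℝ) × (ℕ → Fin m → ℝ))) j) :
        (j : Fin m) → Fin (R j + 1) → ℝ),
      fderiv ℝ Fx (fun j (α : Fin (R j)) => z j α.succ) d₁
        = fderiv ℝ (f (Fx fun j (α : Fin (R j)) => z j α.castSucc)) (Fu z)
            (fderiv ℝ Fu z d₂) := by
  intro d₁ hd₁ d₂ hd₂
  have hfix : shift f (x₀, fun _ => u₀) = (x₀, fun _ => u₀) := Prod.ext heq.symm rfl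
  have hshift : Tendsto (shift f) (𝓝 (x₀, fun _ => u₀)) (𝓝 (x₀, fun _ => u₀)) := by
    simpa only [hfix] using (continuous_shift hf.continuous).tendsto (x₀, fun _ => u₀)
  have hid : ∀ᶠ z in 𝓝 (fun j (α : Fin (R j + 1)) =>
      φ ((shift f)^[(α : ℕ)] (x₀, fun _ => u₀)) j),
      Fx (fun j (α : Fin (R j)) => z j α.succ)
        = f (Fx fun j (α : Fin (R j)) => z j α.castSucc) (Fu z) := by
    refine hflat.nhds_le_map hf hfix (fun j => R j + 1) (mem_map.2 ?_)
    filter_upwards [hpar, hshift.eventually hpar] with p hp hp'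
    change Fx (fun j (α : Fin (R j)) => φ ((shift f)^[(α : ℕ) + 1] p) j)
      = f (Fx fun j (α : Fin (R j)) => φ ((shift f)^[(α : ℕ)] p) j) _
    rw [hp.1, hp.2]
    exact hp'.1
  filter_upwards [hid.eventually_nhds] with z hz
  have hline : HasDerivAt (fun t : ℝ => z + t • d₂) d₂ 0 := by
    simpa using ((hasDerivAt_id (0 : ℝ)).smul_const d₂).const_add z
  have hline₁ : HasDerivAt (fun t : ℝ => fun j (α : Fin (R j)) => (z + t • d₂) j α.succ) d₁ 0 := by
    refine hasDerivAt_pi.2 fun j => hasDerivAt_pi.2 fun α => ?_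
    have hd : d₁ j α = d₂ j α.succ := by
      subst hd₁ hd₂
      have : (α : ℕ) = R s - 1 ↔ (α : ℕ) + 1 = R s := by omega
      simp [this]
    rw [hd]
    exact hasDerivAt_pi.1 (hasDerivAt_pi.1 hline j) α.succ
  have hconst (t : ℝ) : (fun j (α : Fin (R j)) => (z + t • d₂) j α.castSucc)
      = fun j (α : Fin (R j)) => z j α.castSucc := by
    ext j α
    have hd : d₂ j α.castSucc = 0 := by
      subst hd₂
      refine if_neg ?_
      rintro ⟨rfl, h⟩
      exact absurd h α.isLt.ne
    simp [hd]
  have hleft := HasFDerivAt.comp_hasDerivAt (0 : ℝ)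
    (((hFx.differentiable (by simp)).differentiableAt).hasFDerivAt) hline₁
  have hfu : ContDiff ℝ (⊤ : ℕ∞) (f (Fx fun j (α : Fin (R j)) => z j α.castSucc)) :=
    hf.comp (contDiff_prodMk_right _)
  have hright := HasFDerivAt.comp_hasDerivAt (0 : ℝ)
    ((hfu.differentiable (by simp)).differentiableAt).hasFDerivAt
    (HasFDerivAt.comp_hasDerivAt (0 : ℝ)
      (((hFu.differentiable (by simp)).differentiableAt).hasFDerivAt) hline)
  have hz' : Tendsto (fun t : ℝ => z + t • d₂) (𝓝 0) (𝓝 z) := by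
    simpa using hline.continuousAt.tendsto
  have hEq := hleft.unique (hright.congr_of_eventuallyEq ((hz'.eventually hz).mono fun t ht => by
    rw [hconst] at ht
    exact ht))
  simpa using hEq
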